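/- Let g : S → End(S) be a linear map such that, for every r ∈ S, the endomorphism g(r) is ω-symplectic (that is, the bilinear form (s,t) ↦ ω(g(r)s, t) is symmetric), and suppose g(s)s = 0 for every s ∈ S. Then g = 0. (This is the triviality of the first prolongation of the symplectic Lie algebra sp(S) acting on a purely odd space, used in the proof that a degree-three Spencer cocycle (σ,τ) is determined by τ.) -/

import Mathlib

/-!
Statement 13: triviality of the first prolongation of the symplectic Lie algebra
`sp(S)` acting on a purely odd space.  If `g : S → End(S)` is linear, each `g(r)`
is `ω`-symplectic (i.e. `(s,t) ↦ ω(g(r)s, t)` is symmetric), and `g(s)s = 0` for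
all `s`, then `g = 0`.
-/

noncomputable section

theorem first_prolongation_of_sp_on_odd_space_vanishes
    {S : Type} [AddCommGroup S] [Module ℝ S] [FiniteDimensional ℝ S]
    (ω : S →ₗ[ℝ] S →ₗ[ℝ] ℝ)
    (hω_alt : ∀ s : S, ω s s = 0)
    (hω_nondeg : ∀ s : S, (∀ t : S, ω s t = 0) → s = 0)
    (g : S →ₗ[ℝ] Module.End ℝ S)
    (hg_sympl : ∀ (r s t : S), ω (g r s) t = ω (g r t) s)
    (hg_diag : ∀ s : S, g s s = 0) :
    g = 0 := by
  have skew (r s : S) : g r s = -g s r := by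
    have h := hg_diag (r + s)
    simp only [map_add, LinearMap.add_apply, hg_diag, zero_add, add_zero] at h
    exact eq_neg_of_add_eq_zero_right h
  have skew_ω (r s t : S) : ω (g r s) t = -ω (g s r) t := by
    rw [skew r s, map_neg, LinearMap.neg_apply]
  ext r s
  refine hω_nondeg _ fun t => ?_
  linarith [hg_sympl r s t, skew_ω r t s, hg_sympl t r s, skew_ω t s r,
    hg_sympl s t r, skew_ω s r t]

end
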